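/- Let A be a real m×n matrix with nonzero rows, b ∈ ℝ^m, and suppose the system is consistent: A x⋆ = b for some x⋆ ∈ ℝ^n. Suppose P W D⁻² = (α/‖A‖_F²) I for some α > 0, where D = Diag(‖A₁‖,…,‖A_m‖), P = Diag(p₁,…,p_m) with p a probability vector, and W = Diag(w₁,…,w_m). Fix q ≥ 1 and x ∈ ℝ^n with error e = x − x⋆, and for τ : Fin q → Fin m let x'_τ = x − (1/q) Σ_{j ∈ Fin q} w_{τ(j)} ((A_{τ(j)} · x − b_{τ(j)})/‖A_{τ(j)}‖²) A_{τ(j)}ᵀ. Then Σ_{τ} (Π_j p_{τ(j)}) ‖x'_τ − x⋆‖² ≤ λ_max((I − α AᵀA/‖A‖_F²)² + (Aᵀ/‖A‖_F)((α/q) W − (α²/q) A Aᵀ/‖A‖_F²)(A/‖A‖_F)) · ‖e‖², where λ_max denotes the largest eigenvalue of the symmetric matrix. -/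

import Mathlib

open Matrix BigOperators

/-- The largest eigenvalue of a symmetric matrix, as the supremum of the quadratic form
`⟨v, B v⟩` over Euclidean unit vectors `v`. -/
noncomputable def lambdaMax {k : ℕ} (B : Matrix (Fin k) (Fin k) ℝ) : ℝ :=
  sSup {t : ℝ | ∃ v : Fin k → ℝ, (∑ i, v i ^ 2) = 1 ∧ v ⬝ᵥ B.mulVec v = t}

theorem kz_moment {m : ℕ} (p : Fin m → ℝ) (hp1 : ∑ i, p i = 1) (h : Fin m → ℝ) (q : ℕ) :
    ∀ a : ℝ, ∑ τ : Fin q → Fin m, (∏ j, p (τ j)) * (a + ∑ j, h (τ j)) ^ 2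
      = a ^ 2 + 2 * a * q * (∑ i, p i * h i) + q * (∑ i, p i * h i ^ 2)
        + q * (q - 1) * (∑ i, p i * h i) ^ 2 := by
  induction q with
  | zero => intro a; simp
  | succ q ih =>
    intro a
    rw [← (Fin.consEquiv (fun _ : Fin (q + 1) => Fin m)).sum_comp, Fintype.sum_prod_type]
    have key : ∀ i : Fin m, ∑ τ : Fin q → Fin m,
        (∏ j, p ((Fin.consEquiv (fun _ : Fin (q + 1) => Fin m)) (i, τ) j)) *
          (a + ∑ j, h ((Fin.consEquiv (fun _ : Fin (q + 1) => Fin m)) (i, τ) j)) ^ 2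
        = p i * (a ^ 2 + 2 * a * q * (∑ i, p i * h i) + q * (∑ i, p i * h i ^ 2)
            + q * (q - 1) * (∑ i, p i * h i) ^ 2)
          + (p i * h i) * (2 * a + 2 * q * (∑ i, p i * h i)) + p i * h i ^ 2 := by
      intro i
      have h1 := ih (a + h i)
      simp only [Fin.consEquiv, Equiv.coe_fn_mk, Fin.prod_univ_succ, Fin.sum_univ_succ,
        Fin.cons_zero, Fin.cons_succ]
      simp only [mul_assoc, ← Finset.mul_sum, ← add_assoc] at h1 ⊢
      rw [h1]
      ring
    rw [Finset.sum_congr rfl (fun i _ => key i)]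
    rw [Finset.sum_add_distrib, Finset.sum_add_distrib, ← Finset.sum_mul, ← Finset.sum_mul, hp1]
    push_cast
    ring

theorem kz_lambda {k : ℕ} (B : Matrix (Fin k) (Fin k) ℝ) (e : Fin k → ℝ) :
    e ⬝ᵥ B.mulVec e ≤ lambdaMax B * ∑ i, e i ^ 2 := by
  have hb : BddAbove {t : ℝ | ∃ v : Fin k → ℝ, (∑ i, v i ^ 2) = 1 ∧ v ⬝ᵥ B.mulVec v = t} := by
    refine ⟨∑ i, ∑ j, |B i j|, ?_⟩
    rintro t ⟨v, hv, rfl⟩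
    have hle : ∀ i, |v i| ≤ 1 := by
      intro i
      rw [← sq_le_one_iff_abs_le_one, ← hv]
      exact Finset.single_le_sum (f := fun i => v i ^ 2) (fun i _ => sq_nonneg _)
        (Finset.mem_univ i)
    simp only [dotProduct, mulVec, Finset.mul_sum]
    refine Finset.sum_le_sum fun i _ => Finset.sum_le_sum fun j _ => ?_
    refine (le_abs_self _).trans ?_
    rw [abs_mul, abs_mul]
    have h1 := hle i
    have h2 := hle j
    have h3 : |v i| * |v j| ≤ 1 := mul_le_one₀ h1 (abs_nonneg _) h2
    nlinarith [abs_nonneg (B i j)]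
  have hs0 : 0 ≤ ∑ i, e i ^ 2 := Finset.sum_nonneg fun i _ => sq_nonneg _
  rcases hs0.eq_or_lt with h0 | hpos
  · have he : e = 0 := by
      funext i
      have := (Finset.sum_eq_zero_iff_of_nonneg (fun i _ => sq_nonneg (e i))).1 h0.symm i
        (Finset.mem_univ i)
      simpa using this
    subst he
    simp
  · set s := ∑ i, e i ^ 2 with hs
    have hsq : Real.sqrt s ^ 2 = s := Real.sq_sqrt hs0
    have hle : (e ⬝ᵥ B.mulVec e) / s ≤ lambdaMax B := by
      apply le_csSup hb
      refine ⟨(Real.sqrt s)⁻¹ • e, ?_, ?_⟩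
      · simp only [Pi.smul_apply, smul_eq_mul, mul_pow, ← Finset.mul_sum, ← hs, inv_pow, hsq]
        field_simp
      · rw [mulVec_smul, dotProduct_smul, smul_dotProduct, smul_eq_mul, smul_eq_mul, ← mul_assoc,
          ← sq, inv_pow, hsq]
        field_simp
    rwa [div_le_iff₀ hpos] at hle

/-- For a consistent system `A x⋆ = b`, under the coupling condition
`P W D⁻² = (α/‖A‖_F²) I`, the expected squared error of one averaged randomized Kaczmarz step
satisfies
`E‖x' − x⋆‖² ≤ λ_max((I − α AᵀA/‖A‖_F²)² + (Aᵀ/‖A‖_F)((α/q) W − (α²/q) A Aᵀ/‖A‖_F²)(A/‖A‖_F)) ‖e‖²`. -/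
theorem averaged_kaczmarz_consistent_bound
    {m n : ℕ} (A : Matrix (Fin m) (Fin n) ℝ) (hrows : ∀ i : Fin m, A i ≠ 0)
    (b : Fin m → ℝ) (xstar : Fin n → ℝ)
    (hconsist : A.mulVec xstar = b)
    (w p : Fin m → ℝ) (hp0 : ∀ i, 0 ≤ p i) (hp1 : ∑ i, p i = 1)
    (F : ℝ) (hF : F = ∑ i, ∑ j, A i j ^ 2)
    (D P W : Matrix (Fin m) (Fin m) ℝ)
    (hD : D = Matrix.diagonal (fun i => Real.sqrt (∑ l, A i l ^ 2)))
    (hP : P = Matrix.diagonal p) (hW : W = Matrix.diagonal w)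
    (α : ℝ) (hα : 0 < α)
    (hcouple : P * W * (D ^ 2)⁻¹ = (α / F) • (1 : Matrix (Fin m) (Fin m) ℝ))
    (q : ℕ) (hq : 1 ≤ q) (x : Fin n → ℝ)
    (x' : (Fin q → Fin m) → Fin n → ℝ)
    (hx' : ∀ τ, x' τ = x - (q : ℝ)⁻¹ •
      (∑ j : Fin q, (w (τ j) * ((∑ l, A (τ j) l * x l) - b (τ j)) / (∑ l, A (τ j) l ^ 2)) •
        A (τ j))) :
    ∑ τ : Fin q → Fin m, (∏ j, p (τ j)) * (∑ i, (x' τ i - xstar i) ^ 2) ≤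
      lambdaMax (((1 : Matrix (Fin n) (Fin n) ℝ) - (α / F) • (Aᵀ * A)) ^ 2
          + F⁻¹ • (Aᵀ * ((α / (q : ℝ)) • W - (α ^ 2 / ((q : ℝ) * F)) • (A * Aᵀ)) * A)) *
        (∑ i, (x i - xstar i) ^ 2) := by
  subst hD hP hW
  have hs : ∀ i, 0 < ∑ l, A i l ^ 2 := by
    intro i
    have h0 : 0 ≤ ∑ l, A i l ^ 2 := Finset.sum_nonneg fun l _ => sq_nonneg _
    refine lt_of_le_of_ne h0 fun h => hrows i ?_
    funext l
    have := (Finset.sum_eq_zero_iff_of_nonneg (fun l _ => sq_nonneg (A i l))).1 h.symm l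
      (Finset.mem_univ l)
    simpa using this
  have hq0 : (q : ℝ) ≠ 0 := by positivity
  have hc : ∀ i, p i * w i / (∑ l, A i l ^ 2) = α / F := by
    have hdd : ((Matrix.diagonal (fun i => Real.sqrt (∑ l, A i l ^ 2))) ^ 2)⁻¹
        = Matrix.diagonal (fun i => (∑ l, A i l ^ 2)⁻¹) := by
      apply Matrix.inv_eq_right_inv
      rw [Matrix.diagonal_pow, Matrix.diagonal_mul_diagonal, ← Matrix.diagonal_one]
      congr 1
      funext i
      simp only [Pi.pow_apply]
      rw [Real.sq_sqrt (hs i).le, mul_inv_cancel₀ (hs i).ne']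
    intro i
    rw [hdd, Matrix.diagonal_mul_diagonal, Matrix.diagonal_mul_diagonal] at hcouple
    have := congrFun (congrFun hcouple i) i
    simpa [div_eq_mul_inv] using this
  set e : Fin n → ℝ := x - xstar with he
  have hee : ∀ i, x i - xstar i = e i := fun i => rfl
  set y : Fin m → ℝ := A.mulVec e with hy
  set z : Fin n → ℝ := Aᵀ.mulVec y with hz
  have hyx : ∀ k, (∑ l, A k l * x l) - b k = y k := by
    intro k
    rw [hy, he, Matrix.mulVec_sub, hconsist]
    rfl
  have hstep : ∀ τ i, x' τ i - xstar i
      = e i + ∑ j, (-(q : ℝ)⁻¹ * (w (τ j) * y (τ j) / (∑ l, A (τ j) l ^ 2) * A (τ j) i)) := by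
    intro τ i
    rw [hx' τ, ← Finset.mul_sum, ← hee]
    simp only [hyx, Pi.sub_apply, Pi.smul_apply, Finset.sum_apply, smul_eq_mul]
    ring
  refine le_trans (le_of_eq ?_) (kz_lambda _ e)
  have hzi : ∀ i, ∑ k, A k i * y k = z i := fun i => rfl
  have hL : ∀ i, ∑ τ : Fin q → Fin m, (∏ j, p (τ j)) * (x' τ i - xstar i) ^ 2
      = e i ^ 2 - 2 * (α / F) * (e i * z i) + (α / F) ^ 2 * z i ^ 2
        + (q : ℝ)⁻¹ * (α / F) * (∑ k, w k * y k ^ 2 / (∑ l, A k l ^ 2) * A k i ^ 2)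
        - (q : ℝ)⁻¹ * (α / F) ^ 2 * z i ^ 2 := by
    intro i
    simp only [hstep]
    rw [kz_moment p hp1
      (fun k => -(q : ℝ)⁻¹ * (w k * y k / (∑ l, A k l ^ 2) * A k i)) q (e i)]
    have e1 : ∑ k, p k * (-(q : ℝ)⁻¹ * (w k * y k / (∑ l, A k l ^ 2) * A k i))
        = -(q : ℝ)⁻¹ * (α / F) * z i := by
      rw [← hzi, Finset.mul_sum]
      refine Finset.sum_congr rfl fun k _ => ?_
      rw [← hc k]
      ring
    have e2 : ∑ k, p k * (-(q : ℝ)⁻¹ * (w k * y k / (∑ l, A k l ^ 2) * A k i)) ^ 2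
        = (q : ℝ)⁻¹ ^ 2 * (α / F) * ∑ k, w k * y k ^ 2 / (∑ l, A k l ^ 2) * A k i ^ 2 := by
      rw [Finset.mul_sum]
      refine Finset.sum_congr rfl fun k _ => ?_
      rw [← hc k]
      ring
    rw [e1, e2]
    generalize α / F = c
    field_simp
    ring
  have hLHS : ∑ τ : Fin q → Fin m, (∏ j, p (τ j)) * (∑ i, (x' τ i - xstar i) ^ 2)
      = e ⬝ᵥ e - 2 * (α / F) * (e ⬝ᵥ z) + (α / F) ^ 2 * (z ⬝ᵥ z)
        + (q : ℝ)⁻¹ * (α / F) * (∑ k, w k * y k ^ 2)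
        - (q : ℝ)⁻¹ * (α / F) ^ 2 * (z ⬝ᵥ z) := by
    simp only [Finset.mul_sum (s := (Finset.univ : Finset (Fin n)))]
    rw [Finset.sum_comm, Finset.sum_congr rfl (fun i _ => hL i)]
    have e3 : ∑ i, ∑ k, w k * y k ^ 2 / (∑ l, A k l ^ 2) * A k i ^ 2 = ∑ k, w k * y k ^ 2 := by
      rw [Finset.sum_comm]
      refine Finset.sum_congr rfl fun k _ => ?_
      rw [← Finset.mul_sum, div_mul_cancel₀ _ (hs k).ne']
    rw [← e3]
    simp only [Finset.sum_sub_distrib, Finset.sum_add_distrib, ← Finset.mul_sum, dotProduct, sq]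
  have hsymm : ∀ u v : Fin n → ℝ, u ⬝ᵥ (Aᵀ * A).mulVec v = (Aᵀ * A).mulVec u ⬝ᵥ v := by
    intro u v
    rw [Matrix.dotProduct_mulVec, ← Matrix.mulVec_transpose, Matrix.transpose_mul,
      Matrix.transpose_transpose]
  have hGe : (Aᵀ * A).mulVec e = z := by rw [← Matrix.mulVec_mulVec]
  have hAT : ∀ v, e ⬝ᵥ Aᵀ.mulVec v = y ⬝ᵥ v := by
    intro v
    rw [Matrix.dotProduct_mulVec, Matrix.vecMul_transpose]
  have q1 : e ⬝ᵥ (((1 : Matrix (Fin n) (Fin n) ℝ) - (α / F) • (Aᵀ * A)) ^ 2).mulVec e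
      = e ⬝ᵥ e - 2 * (α / F) * (e ⬝ᵥ z) + (α / F) ^ 2 * (z ⬝ᵥ z) := by
    rw [sq, ← Matrix.mulVec_mulVec]
    simp only [Matrix.sub_mulVec, Matrix.one_mulVec, Matrix.smul_mulVec, hGe,
      Matrix.mulVec_sub, Matrix.mulVec_smul, dotProduct_sub, dotProduct_smul, hsymm, smul_eq_mul]
    ring
  have q2 : e ⬝ᵥ (F⁻¹ • (Aᵀ * ((α / (q : ℝ)) • Matrix.diagonal w
        - (α ^ 2 / ((q : ℝ) * F)) • (A * Aᵀ)) * A)).mulVec e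
      = (q : ℝ)⁻¹ * (α / F) * (∑ k, w k * y k ^ 2) - (q : ℝ)⁻¹ * (α / F) ^ 2 * (z ⬝ᵥ z) := by
    have e4 : y ⬝ᵥ (Matrix.diagonal w).mulVec y = ∑ k, w k * y k ^ 2 := by
      simp only [dotProduct, Matrix.mulVec_diagonal]
      exact Finset.sum_congr rfl fun k _ => by ring
    have e5 : y ⬝ᵥ (A * Aᵀ).mulVec y = z ⬝ᵥ z := by
      rw [← Matrix.mulVec_mulVec, Matrix.dotProduct_mulVec, ← Matrix.mulVec_transpose]
    rw [Matrix.smul_mulVec, dotProduct_smul, ← Matrix.mulVec_mulVec, ← Matrix.mulVec_mulVec, hAT,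
      ← hy, Matrix.sub_mulVec, Matrix.smul_mulVec, Matrix.smul_mulVec, dotProduct_sub,
      dotProduct_smul, dotProduct_smul, e4, e5]
    simp only [smul_eq_mul, div_eq_mul_inv, mul_inv]
    ring
  rw [hLHS, Matrix.add_mulVec, dotProduct_add, q1, q2]
  ring
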